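/- arXiv:0810.1268 — 10 statements merged into one kernel-verified Lean document; each statement's English description precedes it below -/
import Mathlib

section
/- Let m ≥ 1 be a natural number and c > 0 a real number. The supremum of R_a + R_b over all Δ₁ ∈ [0,1] and all reals R_a, R_b ≥ 0 satisfying R_a ≤ min(Δ₁c/2, (1−Δ₁)mc), R_b ≤ min(Δ₁c/2, (1−Δ₁)mc), and R_a + R_b ≤ Δ₁c, equals (2m/(2m+1))·c, and it is attained at Δ₁ = 2m/(2m+1) with R_a = R_b = mc/(2m+1). -/
/-- Low-SNR sum-rate optimization of the (m,2) DF MABC protocol with equal linearized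
gains `c = Ph²/ln 2`: the maximum of `R_a + R_b` over `Δ₁ ∈ [0,1]` and nonnegative
rates satisfying `R_a, R_b ≤ min(Δ₁c/2, (1−Δ₁)mc)` and `R_a+R_b ≤ Δ₁c` equals
`(2m/(2m+1))·c`, attained at `Δ₁ = 2m/(2m+1)`, `R_a = R_b = mc/(2m+1)`. -/
theorem mabc_low_snr_sum_rate (m : ℕ) (hm : 1 ≤ m) (c : ℝ) (hc : 0 < c) :
    IsGreatest
      {s : ℝ | ∃ Δ₁ Ra Rb : ℝ, 0 ≤ Δ₁ ∧ Δ₁ ≤ 1 ∧ 0 ≤ Ra ∧ 0 ≤ Rb ∧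
        Ra ≤ min (Δ₁ * c / 2) ((1 - Δ₁) * (m : ℝ) * c) ∧
        Rb ≤ min (Δ₁ * c / 2) ((1 - Δ₁) * (m : ℝ) * c) ∧
        Ra + Rb ≤ Δ₁ * c ∧ s = Ra + Rb}
      (2 * (m : ℝ) / (2 * (m : ℝ) + 1) * c) ∧
    (0 ≤ 2 * (m : ℝ) / (2 * (m : ℝ) + 1) ∧ 2 * (m : ℝ) / (2 * (m : ℝ) + 1) ≤ 1 ∧
      (m : ℝ) * c / (2 * (m : ℝ) + 1) ≤
        min ((2 * (m : ℝ) / (2 * (m : ℝ) + 1)) * c / 2)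
          ((1 - 2 * (m : ℝ) / (2 * (m : ℝ) + 1)) * (m : ℝ) * c) ∧
      (m : ℝ) * c / (2 * (m : ℝ) + 1) + (m : ℝ) * c / (2 * (m : ℝ) + 1) ≤
        (2 * (m : ℝ) / (2 * (m : ℝ) + 1)) * c ∧
      (m : ℝ) * c / (2 * (m : ℝ) + 1) + (m : ℝ) * c / (2 * (m : ℝ) + 1) =
        2 * (m : ℝ) / (2 * (m : ℝ) + 1) * c) := by
  have hm0 : (0 : ℝ) ≤ m := Nat.cast_nonneg m
  have hpos : 0 < 2 * (m : ℝ) + 1 := by positivity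
  have hsum : (m : ℝ) * c / (2 * (m : ℝ) + 1) + (m : ℝ) * c / (2 * (m : ℝ) + 1) =
      2 * (m : ℝ) / (2 * (m : ℝ) + 1) * c := by ring
  have hΔ0 : 0 ≤ 2 * (m : ℝ) / (2 * (m : ℝ) + 1) := by positivity
  have hΔ1 : 2 * (m : ℝ) / (2 * (m : ℝ) + 1) ≤ 1 := by
    rw [div_le_one hpos]
    linarith
  have hR0 : 0 ≤ (m : ℝ) * c / (2 * (m : ℝ) + 1) := by positivity
  have hmin : (m : ℝ) * c / (2 * (m : ℝ) + 1) ≤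
      min ((2 * (m : ℝ) / (2 * (m : ℝ) + 1)) * c / 2)
        ((1 - 2 * (m : ℝ) / (2 * (m : ℝ) + 1)) * (m : ℝ) * c) := by
    refine le_min (le_of_eq (by ring)) (le_of_eq ?_)
    field_simp
    ring
  refine ⟨⟨⟨_, _, _, hΔ0, hΔ1, hR0, hR0, hmin, hmin, hsum.le, hsum.symm⟩, ?_⟩,
    hΔ0, hΔ1, hmin, hsum.le, hsum⟩
  rintro s ⟨Δ, Ra, Rb, -, -, -, -, ha, hb, hab, rfl⟩
  have ha' := ha.trans (min_le_right _ _)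
  have hb' := hb.trans (min_le_right _ _)
  rw [div_mul_eq_mul_div, le_div_iff₀ hpos]
  linarith [mul_le_mul_of_nonneg_left hab hm0]
end

section
/- Let m ≥ 1 be a natural number and P, h > 0 real numbers, and set C(x) = log₂(1+x). The supremum of R_a + R_b over all nonnegative reals (Δ₁,…,Δ_{m+2}) summing to 1 and all reals R_a, R_b ≥ 0 satisfying R_a ≤ min_{1≤k≤m+1} Σ_{i=1}^{k} Δ_{m+3−i}·C(Ph²) and R_b ≤ min_{1≤k≤m+1} Σ_{i=1}^{k} Δ_i·C(Ph²), equals C(Ph²) = log₂(1+Ph²); in particular this optimized sum rate is independent of the number of relays m, and it is attained at every duration vector with Δ₁ + Δ_{m+2} = 1. -/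
theorem first_le_sum_Icc (f : ℕ → ℝ) {k : ℕ} (hk : 1 ≤ k)
    (hf : ∀ i ∈ Finset.Icc 1 k, 0 ≤ f i) : f 1 ≤ ∑ i ∈ Finset.Icc 1 k, f i :=
  Finset.single_le_sum hf (Finset.mem_Icc.2 ⟨le_rfl, hk⟩)

/-- Sum-rate optimization of the Gaussian (m, m+2) DF MHMR protocol with equal squared
channel gains `h²` and power `P`: the maximum of `R_a + R_b` over duration vectors
`(Δ₁,…,Δ_{m+2})` equals `C(Ph²) = log₂(1+Ph²)` (independently of `m`), and it is
attained at every duration vector with `Δ₁ + Δ_{m+2} = 1`. -/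
theorem mhmr_gaussian_sum_rate (m : ℕ) (hm : 1 ≤ m) (P h : ℝ) (hP : 0 < P) (hh : 0 < h)
    (Cv : ℝ) (hCv : Cv = Real.logb 2 (1 + P * h ^ 2)) :
    IsGreatest
      {s : ℝ | ∃ (Δ : ℕ → ℝ) (Ra Rb : ℝ),
        (∀ i ∈ Finset.Icc 1 (m + 2), 0 ≤ Δ i) ∧
        (∑ i ∈ Finset.Icc 1 (m + 2), Δ i) = 1 ∧ 0 ≤ Ra ∧ 0 ≤ Rb ∧
        (∀ k ∈ Finset.Icc 1 (m + 1), Ra ≤ ∑ i ∈ Finset.Icc 1 k, Δ (m + 3 - i) * Cv) ∧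
        (∀ k ∈ Finset.Icc 1 (m + 1), Rb ≤ ∑ i ∈ Finset.Icc 1 k, Δ i * Cv) ∧
        s = Ra + Rb}
      Cv ∧
    ∀ Δ : ℕ → ℝ, (∀ i ∈ Finset.Icc 1 (m + 2), 0 ≤ Δ i) →
      (∑ i ∈ Finset.Icc 1 (m + 2), Δ i) = 1 → Δ 1 + Δ (m + 2) = 1 →
      ∃ Ra Rb : ℝ, 0 ≤ Ra ∧ 0 ≤ Rb ∧
        (∀ k ∈ Finset.Icc 1 (m + 1), Ra ≤ ∑ i ∈ Finset.Icc 1 k, Δ (m + 3 - i) * Cv) ∧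
        (∀ k ∈ Finset.Icc 1 (m + 1), Rb ≤ ∑ i ∈ Finset.Icc 1 k, Δ i * Cv) ∧
        Ra + Rb = Cv := by
  have hC : 0 ≤ Cv := by
    rw [hCv]
    exact Real.logb_nonneg one_lt_two (by nlinarith [mul_pos hP (pow_pos hh 2)])
  have attained : ∀ Δ : ℕ → ℝ, (∀ i ∈ Finset.Icc 1 (m + 2), 0 ≤ Δ i) →
      Δ 1 + Δ (m + 2) = 1 →
      ∃ Ra Rb : ℝ, 0 ≤ Ra ∧ 0 ≤ Rb ∧
        (∀ k ∈ Finset.Icc 1 (m + 1), Ra ≤ ∑ i ∈ Finset.Icc 1 k, Δ (m + 3 - i) * Cv) ∧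
        (∀ k ∈ Finset.Icc 1 (m + 1), Rb ≤ ∑ i ∈ Finset.Icc 1 k, Δ i * Cv) ∧
        Ra + Rb = Cv := by
    intro Δ hΔ hends
    refine ⟨Δ (m + 2) * Cv, Δ 1 * Cv,
      mul_nonneg (hΔ _ (Finset.mem_Icc.2 (by omega))) hC,
      mul_nonneg (hΔ _ (Finset.mem_Icc.2 (by omega))) hC, ?_, ?_, ?_⟩
    · intro k hk
      rw [Finset.mem_Icc] at hk
      refine first_le_sum_Icc (fun i => Δ (m + 3 - i) * Cv) hk.1 fun i hi => ?_
      rw [Finset.mem_Icc] at hi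
      exact mul_nonneg (hΔ _ (Finset.mem_Icc.2 (by omega))) hC
    · intro k hk
      rw [Finset.mem_Icc] at hk
      refine first_le_sum_Icc (fun i => Δ i * Cv) hk.1 fun i hi => ?_
      rw [Finset.mem_Icc] at hi
      exact mul_nonneg (hΔ _ (Finset.mem_Icc.2 (by omega))) hC
    · rw [← add_mul, add_comm, hends, one_mul]
  refine ⟨⟨?_, ?_⟩, fun Δ hΔ _ hends => attained Δ hΔ hends⟩
  · have hΔ : ∀ i ∈ Finset.Icc 1 (m + 2), (0 : ℝ) ≤ if i = 1 then 1 else 0 := by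
      intro i _
      split_ifs <;> norm_num
    obtain ⟨Ra, Rb, hRa, hRb, hka, hkb, hsum⟩ :=
      attained (fun i => if i = 1 then 1 else 0) hΔ (by simp)
    exact ⟨_, Ra, Rb, hΔ, by simp, hRa, hRb, hka, hkb, hsum.symm⟩
  · rintro s ⟨Δ, Ra, Rb, hΔ, hsum, -, -, hka, hkb, rfl⟩
    have hRa := hka 1 (Finset.mem_Icc.2 (by omega))
    have hRb := hkb 1 (Finset.mem_Icc.2 (by omega))
    rw [Finset.Icc_self, Finset.sum_singleton] at hRa hRb
    have hends : Δ 1 + Δ (m + 2) ≤ 1 := by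
      rw [← hsum, Finset.sum_Icc_succ_top (by omega)]
      refine add_le_add_left (first_le_sum_Icc Δ (by omega) fun i hi => hΔ i ?_) _
      exact Finset.Icc_subset_Icc_right (by omega) hi
    calc Ra + Rb ≤ Δ (m + 2) * Cv + Δ 1 * Cv := add_le_add hRa hRb
      _ = (Δ 1 + Δ (m + 2)) * Cv := by ring
      _ ≤ Cv := mul_le_of_le_one_left hC hends
end

section
/- Let m ≥ 1 be a natural number and h > 0. Let R_in(P) = log₂(1+Ph²) be the optimized achievable sum rate of the Gaussian (m,m+2) DF MHMR protocol with equal squared gains h², and let R_out(P) = sup_Δ (OutA(Δ) + OutB(Δ)) be the optimized cut-set outer-bound sum rate, where for a duration vector Δ = (Δ₁,…,Δ_{m+2}) of nonnegative reals summing to 1, OutA(Δ) = min_{S ⊆ {1,…,m}} Σ_{i ∈ S∪{0}} Δ_{m+2−i}·log₂(1+(m+1−|S|)Ph²) and OutB(Δ) = min_{S ⊆ {1,…,m}} Σ_{i ∈ S∪{m+1}} Δ_{m+2−i}·log₂(1+(m+1−|S|)Ph²). Then lim_{P→∞} R_in(P)/R_out(P) = 1; that is, the high-SNR multiplicative gap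 G_H of the (m,m+2) DF MHMR protocol equals 1. -/
/-- The rate of the cut `insert j S` in the Gaussian `(m, m+2)` relay network with durations `Δ`. -/
noncomputable def cutRate (m : ℕ) (Δ : ℕ → ℝ) (P h : ℝ) (j : ℕ) (S : Finset ℕ) : ℝ :=
  ∑ i ∈ insert j S, Δ (m + 2 - i) *
    Real.logb 2 (1 + ((m : ℝ) + 1 - (S.card : ℝ)) * P * h ^ 2)

/-- The minimal cut rate over all sets of relays on the side of node `j`. -/
noncomputable def minCutRate (m : ℕ) (Δ : ℕ → ℝ) (P h : ℝ) (j : ℕ) : ℝ :=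
  sInf {y : ℝ | ∃ S : Finset ℕ, S ⊆ Finset.Icc 1 m ∧ y = cutRate m Δ P h j S}

lemma le_minCutRate {m : ℕ} {Δ : ℕ → ℝ} {P h a : ℝ} {j : ℕ}
    (H : ∀ S ⊆ Finset.Icc 1 m, a ≤ cutRate m Δ P h j S) : a ≤ minCutRate m Δ P h j := by
  refine le_csInf ⟨_, ∅, Finset.empty_subset _, rfl⟩ ?_
  rintro _ ⟨S, hS, rfl⟩
  exact H S hS

lemma logb_le_logb_cut {m : ℕ} {P h : ℝ} (hP : 0 ≤ P) {S : Finset ℕ}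
    (hS : S ⊆ Finset.Icc 1 m) :
    Real.logb 2 (1 + P * h ^ 2) ≤
      Real.logb 2 (1 + ((m : ℝ) + 1 - (S.card : ℝ)) * P * h ^ 2) := by
  have hcard : (S.card : ℝ) ≤ m := by
    have := Finset.card_le_card hS
    rw [Nat.card_Icc, Nat.add_sub_cancel] at this
    exact_mod_cast this
  have hx : 0 ≤ P * h ^ 2 := by positivity
  refine Real.logb_le_logb_of_le one_lt_two (by positivity) ?_
  nlinarith [mul_nonneg (sub_nonneg.2 hcard) hx]

lemma logb_one_add_nonneg {P h : ℝ} (hP : 0 ≤ P) : 0 ≤ Real.logb 2 (1 + P * h ^ 2) :=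
  Real.logb_nonneg one_lt_two (le_add_of_nonneg_right (by positivity))

lemma cutRate_term_nonneg {m : ℕ} {Δ : ℕ → ℝ} {P h : ℝ} {j : ℕ} (hP : 0 ≤ P)
    (hΔ : ∀ i ∈ Finset.Icc 1 (m + 2), 0 ≤ Δ i) (hj : j ≤ m + 1)
    {S : Finset ℕ} (hS : S ⊆ Finset.Icc 1 m) {i : ℕ} (hi : i ∈ insert j S) :
    0 ≤ Δ (m + 2 - i) * Real.logb 2 (1 + ((m : ℝ) + 1 - (S.card : ℝ)) * P * h ^ 2) := by
  refine mul_nonneg (hΔ _ ?_) ((logb_one_add_nonneg hP).trans (logb_le_logb_cut hP hS))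
  rcases Finset.mem_insert.1 hi with rfl | hi
  · rw [Finset.mem_Icc]; omega
  · have := Finset.mem_Icc.1 (hS hi)
    rw [Finset.mem_Icc]; omega

lemma minCutRate_le {m : ℕ} {Δ : ℕ → ℝ} {P h : ℝ} {j : ℕ} (hP : 0 ≤ P)
    (hΔ : ∀ i ∈ Finset.Icc 1 (m + 2), 0 ≤ Δ i) (hj : j ≤ m + 1) :
    minCutRate m Δ P h j ≤ Δ (m + 2 - j) * Real.logb 2 (1 + ((m : ℝ) + 1) * P * h ^ 2) := by
  refine csInf_le ⟨0, ?_⟩ ⟨∅, Finset.empty_subset _, by simp [cutRate]⟩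
  rintro _ ⟨S, hS, rfl⟩
  exact Finset.sum_nonneg fun i hi => cutRate_term_nonneg hP hΔ hj hS hi

/-- The cut-set sum rate is at most the capacity of the cut that isolates a terminal. -/
lemma minCutRate_add_le {m : ℕ} {Δ : ℕ → ℝ} {P h : ℝ} (hP : 0 ≤ P)
    (hΔ : ∀ i ∈ Finset.Icc 1 (m + 2), 0 ≤ Δ i)
    (hsum : ∑ i ∈ Finset.Icc 1 (m + 2), Δ i = 1) :
    minCutRate m Δ P h 0 + minCutRate m Δ P h (m + 1) ≤
      Real.logb 2 (1 + ((m : ℝ) + 1) * P * h ^ 2) := by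
  have h0 := minCutRate_le (h := h) hP hΔ (Nat.zero_le (m + 1))
  have h1 := minCutRate_le (h := h) hP hΔ (le_refl (m + 1))
  have hL : 0 ≤ Real.logb 2 (1 + ((m : ℝ) + 1) * P * h ^ 2) :=
    Real.logb_nonneg one_lt_two (le_add_of_nonneg_right (by positivity))
  have hpair : Δ (m + 2) + Δ 1 ≤ 1 := by
    rw [← hsum, ← Finset.sum_pair (by omega : m + 2 ≠ 1)]
    refine Finset.sum_le_sum_of_subset_of_nonneg ?_ fun i hi _ => hΔ i hi
    intro i hi
    simp only [Finset.mem_insert, Finset.mem_singleton] at hi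
    rw [Finset.mem_Icc]; omega
  rw [Nat.sub_zero] at h0
  rw [show m + 2 - (m + 1) = 1 by omega] at h1
  nlinarith [mul_le_mul_of_nonneg_right hpair hL]

/-- Letting terminal `a` transmit all the time attains the point-to-point rate. -/
lemma le_minCutRate_add_single {m : ℕ} {P h : ℝ} (hP : 0 ≤ P) :
    Real.logb 2 (1 + P * h ^ 2) ≤
      minCutRate m (Pi.single (m + 2) 1) P h 0 +
        minCutRate m (Pi.single (m + 2) 1) P h (m + 1) := by
  have hΔ : ∀ i ∈ Finset.Icc 1 (m + 2), 0 ≤ (Pi.single (m + 2) 1 : ℕ → ℝ) i := fun i _ => by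
    rw [Pi.single_apply]; positivity
  rw [← add_zero (Real.logb 2 _)]
  refine add_le_add (le_minCutRate fun S hS => ?_) (le_minCutRate fun S hS => ?_)
  · refine le_trans ?_ (Finset.single_le_sum
      (fun i hi => cutRate_term_nonneg hP hΔ (Nat.zero_le _) hS hi) (Finset.mem_insert_self 0 S))
    simpa using logb_le_logb_cut hP hS
  · exact Finset.sum_nonneg fun i hi => cutRate_term_nonneg hP hΔ le_rfl hS hi

/-- Scaling the signal-to-noise ratio by a constant does not affect the capacity to first order. -/
lemma tendsto_logb_div_logb_scaled {c : ℝ} (hc : 1 ≤ c) {h : ℝ} (hh : 0 < h) :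
    Filter.Tendsto (fun P : ℝ => Real.logb 2 (1 + P * h ^ 2) / Real.logb 2 (1 + c * P * h ^ 2))
      Filter.atTop (nhds 1) := by
  have hL : Filter.Tendsto (fun P : ℝ => Real.logb 2 (1 + P * h ^ 2)) Filter.atTop Filter.atTop :=
    (Real.tendsto_logb_atTop one_lt_two).comp (Filter.tendsto_atTop_add_const_left _ _
      (Filter.tendsto_id.atTop_mul_const (by positivity)))
  have hlow : Filter.Tendsto (fun P : ℝ => (1 + Real.logb 2 c / Real.logb 2 (1 + P * h ^ 2))⁻¹)
      Filter.atTop (nhds 1) := by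
    simpa using ((hL.const_div_atTop (Real.logb 2 c)).const_add 1).inv₀ (by simp)
  refine tendsto_of_tendsto_of_tendsto_of_le_of_le' hlow tendsto_const_nhds ?_ ?_ <;>
    filter_upwards [hL.eventually_gt_atTop 0, Filter.eventually_ge_atTop 0] with P hpos hP
  all_goals
    have hx : 0 ≤ P * h ^ 2 := by positivity
    have hle : Real.logb 2 (1 + P * h ^ 2) ≤ Real.logb 2 (1 + c * P * h ^ 2) :=
      Real.logb_le_logb_of_le one_lt_two (by positivity) (by nlinarith)
  · have hup : Real.logb 2 (1 + c * P * h ^ 2) ≤ Real.logb 2 c + Real.logb 2 (1 + P * h ^ 2) := by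
      rw [← Real.logb_mul (by positivity) (by positivity)]
      exact Real.logb_le_logb_of_le one_lt_two (by positivity) (by nlinarith)
    rw [one_add_div hpos.ne', inv_div, add_comm _ (Real.logb 2 c)]
    exact div_le_div_of_nonneg_left hpos.le (hpos.trans_le hle) hup
  · exact div_le_one_of_le₀ hle (hpos.trans_le hle).le

/-- The high-SNR multiplicative gap of the Gaussian (m, m+2) DF MHMR protocol with equal
squared gains `h²` equals 1: `lim_{P→∞} R_in(P)/R_out(P) = 1`, where
`R_in(P) = log₂(1+Ph²)` is the optimized achievable sum rate and `R_out(P)` is the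
optimized cut-set outer-bound sum rate. -/
theorem mhmr_high_snr_gap (m : ℕ) (hm : 1 ≤ m) (h : ℝ) (hh : 0 < h)
    (Rin Rout : ℝ → ℝ)
    (hRin : ∀ P : ℝ, Rin P = Real.logb 2 (1 + P * h ^ 2))
    (hRout : ∀ P : ℝ, Rout P = sSup {x : ℝ | ∃ Δ : ℕ → ℝ,
        (∀ i ∈ Finset.Icc 1 (m + 2), 0 ≤ Δ i) ∧
        (∑ i ∈ Finset.Icc 1 (m + 2), Δ i) = 1 ∧
        x = sInf {y : ℝ | ∃ S : Finset ℕ, S ⊆ Finset.Icc 1 m ∧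
              y = ∑ i ∈ insert 0 S, Δ (m + 2 - i) *
                    Real.logb 2 (1 + ((m : ℝ) + 1 - (S.card : ℝ)) * P * h ^ 2)}
          + sInf {y : ℝ | ∃ S : Finset ℕ, S ⊆ Finset.Icc 1 m ∧
              y = ∑ i ∈ insert (m + 1) S, Δ (m + 2 - i) *
                    Real.logb 2 (1 + ((m : ℝ) + 1 - (S.card : ℝ)) * P * h ^ 2)}}) :
    Filter.Tendsto (fun P : ℝ => Rin P / Rout P) Filter.atTop (nhds 1) := by
  have hbounds : ∀ P : ℝ, 0 ≤ P → Real.logb 2 (1 + P * h ^ 2) ≤ Rout P ∧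
      Rout P ≤ Real.logb 2 (1 + ((m : ℝ) + 1) * P * h ^ 2) := by
    intro P hP
    rw [hRout P]
    have hsingle : ∑ i ∈ Finset.Icc 1 (m + 2), (Pi.single (m + 2) 1 : ℕ → ℝ) i = 1 := by
      simp
    have hnonneg : ∀ i ∈ Finset.Icc 1 (m + 2), 0 ≤ (Pi.single (m + 2) 1 : ℕ → ℝ) i := fun i _ => by
      rw [Pi.single_apply]; positivity
    constructor
    · refine (le_minCutRate_add_single (m := m) hP).trans
        (le_csSup ⟨Real.logb 2 (1 + ((m : ℝ) + 1) * P * h ^ 2), ?_⟩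
          ⟨Pi.single (m + 2) 1, hnonneg, hsingle, rfl⟩)
      rintro _ ⟨Δ, hΔ, hsum, rfl⟩
      exact minCutRate_add_le hP hΔ hsum
    · refine csSup_le ⟨_, Pi.single (m + 2) 1, hnonneg, hsingle, rfl⟩ ?_
      rintro _ ⟨Δ, hΔ, hsum, rfl⟩
      exact minCutRate_add_le hP hΔ hsum
  refine tendsto_of_tendsto_of_tendsto_of_le_of_le'
    (tendsto_logb_div_logb_scaled (c := (m : ℝ) + 1) (by simp) hh) tendsto_const_nhds ?_ ?_ <;>
    filter_upwards [Filter.eventually_gt_atTop 0] with P hP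
  all_goals
    obtain ⟨hlo, hup⟩ := hbounds P hP.le
    have hpos : 0 < Real.logb 2 (1 + P * h ^ 2) :=
      Real.logb_pos one_lt_two (lt_add_of_pos_right _ (by positivity))
    rw [hRin P]
  · exact div_le_div_of_nonneg_left hpos.le (hpos.trans_le hlo) hup
  · exact div_le_one_of_le₀ hlo (hpos.trans_le hlo).le
end

section
/- Let m ≥ 1 be a natural number and c > 0 a real number. Define the linearized (m,m+2) MHMR outer-bound sum rate S_out = sup over duration vectors Δ = (Δ₁,…,Δ_{m+2}) (nonnegative, summing to 1) of [min_{S⊆{1,…,m}} Σ_{i∈S∪{0}} Δ_{m+2−i}(m+1−|S|)c + min_{S⊆{1,…,m}} Σ_{i∈S∪{m+1}} Δ_{m+2−i}(m+1−|S|)c]. Then (2(m+1)/(m+2))·c ≤ S_out ≤ 2c. Consequently, the ratio of the linearized optimized achievable sum rate c of the (m,m+2) DF MHMR protocol to S_out lies between 1/2 and (m+2)/(2(m+1)); in particular the low-SNR multiplicative gap of the (m,m+2) DF MHMR protocol with equal gains is at least 1/2, independently of m. -/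
/-- The cut values of one terminal `e` against the relays `1, …, m`. -/
def cutValues (m e : ℕ) (c : ℝ) (Δ : ℕ → ℝ) : Set ℝ :=
  {y : ℝ | ∃ S : Finset ℕ, S ⊆ Finset.Icc 1 m ∧
    y = ∑ i ∈ insert e S, Δ (m + 2 - i) * (((m : ℝ) + 1 - (S.card : ℝ)) * c)}

theorem card_le_of_subset_Icc_one {m : ℕ} {S : Finset ℕ} (hS : S ⊆ Finset.Icc 1 m) :
    (S.card : ℝ) ≤ m := by
  have h := Finset.card_le_card hS
  rw [Nat.card_Icc, Nat.add_sub_cancel] at h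
  exact_mod_cast h

theorem le_of_mem_insert_terminal {m e i : ℕ} {S : Finset ℕ} (he : e ≤ m + 1)
    (hS : S ⊆ Finset.Icc 1 m) (hi : i ∈ insert e S) : i ≤ m + 1 := by
  rcases Finset.mem_insert.1 hi with rfl | hi
  · exact he
  · have := Finset.mem_Icc.1 (hS hi)
    omega

theorem sum_reflect_le {m : ℕ} {Δ : ℕ → ℝ} (hΔ : ∀ i ∈ Finset.Icc 1 (m + 2), 0 ≤ Δ i)
    {T : Finset ℕ} (hT : ∀ i ∈ T, i ≤ m + 1) :
    ∑ i ∈ T, Δ (m + 2 - i) ≤ ∑ i ∈ Finset.Icc 1 (m + 2), Δ i := by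
  have hinj : Set.InjOn (fun i => m + 2 - i) (T : Set ℕ) := by
    intro a ha b hb hab
    have h₁ := hT a ha
    have h₂ := hT b hb
    dsimp only at hab
    omega
  rw [← Finset.sum_image (f := Δ) hinj]
  refine Finset.sum_le_sum_of_subset_of_nonneg ?_ fun i hi _ => hΔ i hi
  intro j hj
  obtain ⟨i, hi, rfl⟩ := Finset.mem_image.1 hj
  have := hT i hi
  exact Finset.mem_Icc.2 ⟨by omega, by omega⟩

theorem cutValues_nonneg {m e : ℕ} {c : ℝ} {Δ : ℕ → ℝ} (he : e ≤ m + 1) (hc : 0 ≤ c)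
    (hΔ : ∀ i ∈ Finset.Icc 1 (m + 2), 0 ≤ Δ i) {y : ℝ} (hy : y ∈ cutValues m e c Δ) :
    0 ≤ y := by
  obtain ⟨S, hS, rfl⟩ := hy
  have hcard := card_le_of_subset_Icc_one hS
  refine Finset.sum_nonneg fun i hi => mul_nonneg (hΔ _ ?_) (mul_nonneg (by linarith) hc)
  have := le_of_mem_insert_terminal he hS hi
  exact Finset.mem_Icc.2 ⟨by omega, by omega⟩

/-- The cut containing all relays bounds the minimum by `c`. -/
theorem sInf_cutValues_le {m e : ℕ} {c : ℝ} {Δ : ℕ → ℝ} (he : e ≤ m + 1) (hc : 0 ≤ c)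
    (hΔ : ∀ i ∈ Finset.Icc 1 (m + 2), 0 ≤ Δ i)
    (hsum : ∑ i ∈ Finset.Icc 1 (m + 2), Δ i = 1) :
    sInf (cutValues m e c Δ) ≤ c := by
  refine (csInf_le ⟨0, fun y hy => cutValues_nonneg he hc hΔ hy⟩
    ⟨Finset.Icc 1 m, subset_rfl, rfl⟩).trans ?_
  have h := sum_reflect_le hΔ (T := insert e (Finset.Icc 1 m))
    fun i hi => le_of_mem_insert_terminal he subset_rfl hi
  rw [← Finset.sum_mul, Nat.card_Icc, Nat.add_sub_cancel, add_sub_cancel_left, one_mul]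
  exact mul_le_of_le_one_left hc (h.trans hsum.le)

/-- Uniform durations make every cut worth at least `(m + 1) / (m + 2) * c`. -/
theorem le_sInf_cutValues_uniform {m e : ℕ} {c : ℝ} (he : e ∉ Finset.Icc 1 m) (hc : 0 ≤ c) :
    ((m : ℝ) + 1) / ((m : ℝ) + 2) * c ≤ sInf (cutValues m e c fun _ => 1 / ((m : ℝ) + 2)) := by
  refine le_csInf ⟨_, ∅, Finset.empty_subset _, rfl⟩ ?_
  rintro y ⟨S, hS, rfl⟩
  have hcard := card_le_of_subset_Icc_one hS
  have hk : (0 : ℝ) ≤ S.card := Nat.cast_nonneg _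
  rw [Finset.sum_const, Finset.card_insert_of_notMem fun h => he (hS h), nsmul_eq_mul]
  push_cast
  have key : (m : ℝ) + 1 ≤ ((S.card : ℝ) + 1) * ((m : ℝ) + 1 - S.card) := by
    nlinarith [mul_nonneg hk (sub_nonneg.2 hcard)]
  calc ((m : ℝ) + 1) / ((m : ℝ) + 2) * c
      ≤ ((S.card : ℝ) + 1) * ((m : ℝ) + 1 - S.card) / ((m : ℝ) + 2) * c := by gcongr
    _ = _ := by ring

/-- Linearized (low-SNR) (m, m+2) MHMR outer-bound sum rate `S_out` with equal gains
(`c = Ph²/ln 2`) satisfies `(2(m+1)/(m+2))·c ≤ S_out ≤ 2c`; consequently the ratio of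
the linearized optimized DF achievable sum rate `c` to `S_out` lies between `1/2` and
`(m+2)/(2(m+1))`, so the low-SNR multiplicative gap is at least `1/2`, independently
of `m`. -/
theorem mhmr_low_snr_gap (m : ℕ) (hm : 1 ≤ m) (c : ℝ) (hc : 0 < c)
    (Sout : ℝ)
    (hSout : Sout = sSup {x : ℝ | ∃ Δ : ℕ → ℝ,
        (∀ i ∈ Finset.Icc 1 (m + 2), 0 ≤ Δ i) ∧
        (∑ i ∈ Finset.Icc 1 (m + 2), Δ i) = 1 ∧
        x = sInf {y : ℝ | ∃ S : Finset ℕ, S ⊆ Finset.Icc 1 m ∧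
              y = ∑ i ∈ insert 0 S, Δ (m + 2 - i) * (((m : ℝ) + 1 - (S.card : ℝ)) * c)}
          + sInf {y : ℝ | ∃ S : Finset ℕ, S ⊆ Finset.Icc 1 m ∧
              y = ∑ i ∈ insert (m + 1) S,
                    Δ (m + 2 - i) * (((m : ℝ) + 1 - (S.card : ℝ)) * c)}}) :
    2 * ((m : ℝ) + 1) / ((m : ℝ) + 2) * c ≤ Sout ∧ Sout ≤ 2 * c ∧
    1 / 2 ≤ c / Sout ∧ c / Sout ≤ ((m : ℝ) + 2) / (2 * ((m : ℝ) + 1)) := by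
  have hm0 : (0 : ℝ) ≤ m := Nat.cast_nonneg m
  have hub : ∀ x ∈ {x : ℝ | ∃ Δ : ℕ → ℝ, (∀ i ∈ Finset.Icc 1 (m + 2), 0 ≤ Δ i) ∧
      (∑ i ∈ Finset.Icc 1 (m + 2), Δ i) = 1 ∧
      x = sInf (cutValues m 0 c Δ) + sInf (cutValues m (m + 1) c Δ)}, x ≤ 2 * c := by
    rintro x ⟨Δ, hΔ, hsum, rfl⟩
    have h₁ := sInf_cutValues_le (Nat.zero_le (m + 1)) hc.le hΔ hsum
    have h₂ := sInf_cutValues_le le_rfl hc.le hΔ hsum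
    linarith
  have hmem : sInf (cutValues m 0 c fun _ => 1 / ((m : ℝ) + 2)) +
      sInf (cutValues m (m + 1) c fun _ => 1 / ((m : ℝ) + 2)) ∈
      {x : ℝ | ∃ Δ : ℕ → ℝ, (∀ i ∈ Finset.Icc 1 (m + 2), 0 ≤ Δ i) ∧
      (∑ i ∈ Finset.Icc 1 (m + 2), Δ i) = 1 ∧
      x = sInf (cutValues m 0 c Δ) + sInf (cutValues m (m + 1) c Δ)} := by
    refine ⟨_, fun i _ => by positivity, ?_, rfl⟩
    rw [Finset.sum_const, Nat.card_Icc, Nat.add_sub_cancel, nsmul_eq_mul]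
    push_cast
    field_simp
  have hle : Sout ≤ 2 * c := hSout.trans_le (csSup_le ⟨_, hmem⟩ hub)
  have hge : 2 * ((m : ℝ) + 1) / ((m : ℝ) + 2) * c ≤ Sout := by
    refine le_trans ?_ ((le_csSup ⟨_, hub⟩ hmem).trans_eq hSout.symm)
    have h₁ := le_sInf_cutValues_uniform (m := m) (e := 0) (by simp) hc.le
    have h₂ := le_sInf_cutValues_uniform (m := m) (e := m + 1) (by simp) hc.le
    calc 2 * ((m : ℝ) + 1) / ((m : ℝ) + 2) * c
        = ((m : ℝ) + 1) / ((m : ℝ) + 2) * c + ((m : ℝ) + 1) / ((m : ℝ) + 2) * c := by ring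
      _ ≤ _ := add_le_add h₁ h₂
  have hpos : 0 < Sout := lt_of_lt_of_le (by positivity) hge
  refine ⟨hge, hle, ?_, ?_⟩
  · rw [div_le_div_iff₀ two_pos hpos]
    linarith
  · rw [div_le_div_iff₀ hpos (by positivity)]
    rw [div_mul_eq_mul_div, div_le_iff₀ (by positivity)] at hge
    linarith
end

section
/- Let m ≥ 1 be a natural number and let f_1,…,f_m and g_1,…,g_m be strictly positive reals. For P > 0 define P̃_i(P) = (P/m)/((P/2)(f_i+g_i)+1) and R_a(P) = (1/2)·log₂(1 + ((P/2)·(Σ_{i=1}^m √(g_i f_i P̃_i(P)))²)/(Σ_{i=1}^m g_i P̃_i(P) + 1)) and R_b(P) = (1/2)·log₂(1 + ((P/2)·(Σ_{i=1}^m √(g_i f_i P̃_i(P)))²)/(Σ_{i=1}^m f_i P̃_i(P) + 1)). Then lim_{P→∞} R_a(P)/log₂ P = 1/2, lim_{P→∞} R_b(P)/log₂ P = 1/2, and hence lim_{P→∞} (R_a(P)+R_b(P))/log₂ P = 1. -/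
open Filter Topology in
/-- If `u x / x` has a positive limit at infinity, then `logb 2 (u x) ∼ logb 2 x`. -/
theorem tendsto_logb_div_logb_of_tendsto_div {u : ℝ → ℝ} {C : ℝ} (hC : 0 < C)
    (hu : Tendsto (fun x => u x / x) atTop (𝓝 C)) :
    Tendsto (fun x => Real.logb 2 (u x) / Real.logb 2 x) atTop (𝓝 1) := by
  have hlog : Tendsto (fun x : ℝ => Real.logb 2 x) atTop atTop :=
    Real.tendsto_logb_atTop one_lt_two
  have hlogu : Tendsto (fun x => Real.logb 2 (u x / x)) atTop (𝓝 (Real.logb 2 C)) :=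
    (hu.log hC.ne').div_const _
  have hsum := (hlogu.div_atTop hlog).const_add 1
  rw [add_zero] at hsum
  refine hsum.congr' ?_
  filter_upwards [eventually_gt_atTop 1, hu.eventually_const_lt hC] with x hx hux
  have hu0 : u x ≠ 0 := by
    intro h
    simp [h] at hux
  have hx0 : Real.logb 2 x ≠ 0 := (Real.logb_pos one_lt_two hx).ne'
  rw [Real.logb_div hu0 (by positivity)]
  field_simp
  ring

open Filter Topology in
/-- The relay amplification power has a limit at high power. -/
theorem tendsto_relay_power (m : ℝ) {s : ℝ} (hs : 0 < s) :
    Tendsto (fun P : ℝ => (P / m) / ((P / 2) * s + 1)) atTop (𝓝 ((1 / m) / (s / 2))) := by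
  have hden : Tendsto (fun P : ℝ => s / 2 + P⁻¹) atTop (𝓝 (s / 2)) := by
    simpa using tendsto_inv_atTop_zero.const_add (s / 2)
  refine ((tendsto_const_nhds (x := 1 / m)).div hden (by positivity)).congr' ?_
  filter_upwards [eventually_gt_atTop 0] with P hP
  have hP' : (P / 2) * s + 1 = P * (s / 2 + P⁻¹) := by
    field_simp
  rw [hP', div_eq_mul_one_div P m, Pi.div_apply, mul_div_mul_left _ _ hP.ne']

open Filter Topology in
/-- An amplify-and-forward rate has pre-log factor `1 / 2` whenever the relay powers have
positive limits; the noise at the receiver is weighted by `w`. -/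
theorem tendsto_af_rate_div_logb {ι : Type*} [Fintype ι] [Nonempty ι] {a w c : ι → ℝ}
    {p : ℝ → ι → ℝ} (ha : ∀ i, 0 < a i) (hw : ∀ i, 0 < w i) (hc : ∀ i, 0 < c i)
    (hp : ∀ i, Tendsto (fun P => p P i) atTop (𝓝 (c i))) :
    Tendsto (fun P => (1 / 2) * Real.logb 2 (1 +
        (P / 2) * (∑ i, Real.sqrt (a i * p P i)) ^ 2 / ((∑ i, w i * p P i) + 1)) /
          Real.logb 2 P) atTop (𝓝 (1 / 2)) := by
  have hS : Tendsto (fun P => ∑ i, Real.sqrt (a i * p P i)) atTop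
      (𝓝 (∑ i, Real.sqrt (a i * c i))) :=
    tendsto_finsetSum _ fun i _ => ((hp i).const_mul (a i)).sqrt
  have hD : Tendsto (fun P => (∑ i, w i * p P i) + 1) atTop (𝓝 ((∑ i, w i * c i) + 1)) :=
    (tendsto_finsetSum _ fun i _ => (hp i).const_mul (w i)).add_const 1
  have hS0 : 0 < ∑ i, Real.sqrt (a i * c i) :=
    Finset.sum_pos (fun i _ => Real.sqrt_pos.2 (mul_pos (ha i) (hc i))) Finset.univ_nonempty
  have hD0 : 0 < (∑ i, w i * c i) + 1 :=
    add_pos_of_nonneg_of_pos (Finset.sum_nonneg fun i _ => (mul_pos (hw i) (hc i)).le) one_pos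
  have hlim := tendsto_inv_atTop_zero.add (((hS.pow 2).const_mul (1 / 2)).div hD hD0.ne')
  rw [zero_add] at hlim
  have hrate := (tendsto_logb_div_logb_of_tendsto_div (by positivity)
    (hlim.congr' (f₂ := fun P => (1 + (P / 2) * (∑ i, Real.sqrt (a i * p P i)) ^ 2 /
      ((∑ i, w i * p P i) + 1)) / P) (by
        filter_upwards [eventually_gt_atTop 0] with P hP
        simp only [Pi.div_apply]
        field_simp))).const_mul (1 / 2)
  simpa only [mul_one, mul_div_assoc] using hrate


/-- High-SNR behavior of the Gaussian (m,2) AF MABC protocol: the achievable rates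
satisfy `R_a(P)/log₂ P → 1/2`, `R_b(P)/log₂ P → 1/2`, and hence the sum rate satisfies
`(R_a(P)+R_b(P))/log₂ P → 1` as `P → ∞`. -/
theorem af_mabc_high_snr (m : ℕ) (hm : 1 ≤ m) (f g : Fin m → ℝ)
    (hf : ∀ i, 0 < f i) (hg : ∀ i, 0 < g i)
    (Pt : ℝ → Fin m → ℝ)
    (hPt : ∀ P i, Pt P i = (P / (m : ℝ)) / ((P / 2) * (f i + g i) + 1))
    (Ra Rb : ℝ → ℝ)
    (hRa : ∀ P, Ra P = (1 / 2) * Real.logb 2 (1 +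
        (P / 2) * (∑ i, Real.sqrt (g i * f i * Pt P i)) ^ 2 /
          ((∑ i, g i * Pt P i) + 1)))
    (hRb : ∀ P, Rb P = (1 / 2) * Real.logb 2 (1 +
        (P / 2) * (∑ i, Real.sqrt (g i * f i * Pt P i)) ^ 2 /
          ((∑ i, f i * Pt P i) + 1))) :
    Filter.Tendsto (fun P => Ra P / Real.logb 2 P) Filter.atTop (nhds (1 / 2)) ∧
    Filter.Tendsto (fun P => Rb P / Real.logb 2 P) Filter.atTop (nhds (1 / 2)) ∧
    Filter.Tendsto (fun P => (Ra P + Rb P) / Real.logb 2 P) Filter.atTop (nhds 1) := by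
  have : Nonempty (Fin m) := ⟨⟨0, hm⟩⟩
  have hm0 : (0 : ℝ) < m := by exact_mod_cast hm
  have hp : ∀ i, Filter.Tendsto (fun P => Pt P i) Filter.atTop
      (nhds ((1 / (m : ℝ)) / ((f i + g i) / 2))) := fun i => by
    simpa only [hPt] using tendsto_relay_power (m : ℝ) (add_pos (hf i) (hg i))
  have hc : ∀ i, 0 < (1 / (m : ℝ)) / ((f i + g i) / 2) := fun i => by
    have := hf i
    have := hg i
    positivity
  have hgf : ∀ i, 0 < g i * f i := fun i => mul_pos (hg i) (hf i)
  have hA : Filter.Tendsto (fun P => Ra P / Real.logb 2 P) Filter.atTop (nhds (1 / 2)) := by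
    simpa only [hRa] using tendsto_af_rate_div_logb hgf hg hc hp
  have hB : Filter.Tendsto (fun P => Rb P / Real.logb 2 P) Filter.atTop (nhds (1 / 2)) := by
    simpa only [hRb] using tendsto_af_rate_div_logb hgf hf hc hp
  refine ⟨hA, hB, ?_⟩
  simpa only [add_div, add_halves] using hA.add hB
end

section
/- Let m ≥ 1 be a natural number, let f_1,…,f_m, g_1,…,g_m and d be strictly positive reals. For P > 0 define P̃_i(P) = (P/m)/(P(f_i+g_i)+2) and R_a(P) = (1/3)·log₂(1 + dP + (P·(Σ_{i=1}^m √(g_i f_i P̃_i(P)))²)/(2·Σ_{i=1}^m g_i P̃_i(P) + 1)) and R_b(P) = (1/3)·log₂(1 + dP + (P·(Σ_{i=1}^m √(g_i f_i P̃_i(P)))²)/(2·Σ_{i=1}^m f_i P̃_i(P) + 1)). Then lim_{P→∞} R_a(P)/log₂ P = 1/3, lim_{P→∞} R_b(P)/log₂ P = 1/3, and hence lim_{P→∞} (R_a(P)+R_b(P))/log₂ P = 2/3. -/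
open Filter Topology

/-- A function squeezed between two positive linear functions has the logarithmic growth of the
identity. -/
lemma tendsto_logb_div_logb_of_linear_bounds {X : ℝ → ℝ} {b c C : ℝ} (hb : 1 < b) (hc : 0 < c)
    (hC : 0 < C) (hlow : ∀ᶠ P in atTop, c * P ≤ X P) (hup : ∀ᶠ P in atTop, X P ≤ C * P) :
    Tendsto (fun P => Real.logb b (X P) / Real.logb b P) atTop (𝓝 1) := by
  have key (k : ℝ) :
      Tendsto (fun P => Real.logb b k / Real.logb b P + 1) atTop (𝓝 1) := by
    simpa using ((Real.tendsto_logb_atTop hb).const_div_atTop (Real.logb b k)).add_const 1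
  have split (k : ℝ) (hk : 0 < k) (P : ℝ) (hP : 1 < P) :
      Real.logb b k / Real.logb b P + 1 = Real.logb b (k * P) / Real.logb b P := by
    have := Real.logb_pos hb hP
    rw [Real.logb_mul hk.ne' (by positivity)]
    field_simp
  refine tendsto_of_tendsto_of_tendsto_of_le_of_le' (key c) (key C) ?_ ?_
  · filter_upwards [hlow, eventually_gt_atTop 1] with P h hP
    have := Real.logb_pos hb hP
    rw [split c hc P hP]
    gcongr
  · filter_upwards [hlow, hup, eventually_gt_atTop 1] with P hl h hP
    have := Real.logb_pos hb hP
    have : 0 < X P := lt_of_lt_of_le (by positivity) hl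
    rw [split C hC P hP]
    gcongr

/-- The pre-log factor of an amplify-and-forward rate: relaying with amplification powers that stay
bounded leaves the signal-to-noise ratio linear in `P`. -/
lemma tendsto_af_rate_div_logb_s12 {ι : Type*} [Fintype ι] {w h B : ι → ℝ} {d : ℝ} {Pt : ℝ → ι → ℝ}
    {R : ℝ → ℝ} (hw : ∀ i, 0 ≤ w i) (hh : ∀ i, 0 ≤ h i) (hd : 0 < d)
    (hPt0 : ∀ P, 0 < P → ∀ i, 0 ≤ Pt P i) (hPtB : ∀ P, 0 < P → ∀ i, Pt P i ≤ B i)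
    (hR : ∀ P, R P = (1 / 3) * Real.logb 2 (1 + d * P +
        P * (∑ i, Real.sqrt (w i * Pt P i)) ^ 2 / (2 * (∑ i, h i * Pt P i) + 1))) :
    Tendsto (fun P => R P / Real.logb 2 P) atTop (𝓝 (1 / 3)) := by
  set S := ∑ i, Real.sqrt (w i * B i)
  have hden (P : ℝ) (hP : 0 < P) : 1 ≤ 2 * (∑ i, h i * Pt P i) + 1 := by
    have : 0 ≤ ∑ i, h i * Pt P i :=
      Finset.sum_nonneg fun i _ => mul_nonneg (hh i) (hPt0 P hP i)
    linarith
  have hlim := tendsto_logb_div_logb_of_linear_bounds (b := 2) (c := d) (C := 1 + d + S ^ 2)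
    (X := fun P => 1 + d * P +
      P * (∑ i, Real.sqrt (w i * Pt P i)) ^ 2 / (2 * (∑ i, h i * Pt P i) + 1))
    one_lt_two hd (by positivity) ?_ ?_
  · simpa only [hR, mul_div_assoc, mul_one] using hlim.const_mul (1 / 3)
  · filter_upwards [eventually_gt_atTop 0] with P hP
    have := hden P hP
    have : 0 ≤ P * (∑ i, Real.sqrt (w i * Pt P i)) ^ 2 / (2 * (∑ i, h i * Pt P i) + 1) := by
      positivity
    linarith
  · filter_upwards [eventually_ge_atTop 1] with P hP
    have hP0 : 0 < P := by linarith
    have hS : ∑ i, Real.sqrt (w i * Pt P i) ≤ S :=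
      Finset.sum_le_sum fun i _ =>
        Real.sqrt_le_sqrt (mul_le_mul_of_nonneg_left (hPtB P hP0 i) (hw i))
    have : P * (∑ i, Real.sqrt (w i * Pt P i)) ^ 2 / (2 * (∑ i, h i * Pt P i) + 1) ≤ P * S ^ 2 :=
      (div_le_self (by positivity) (hden P hP0)).trans (by gcongr)
    linarith

/-- High-SNR behavior of the Gaussian (m,3) AF TDBC protocol: the achievable rates
satisfy `R_a(P)/log₂ P → 1/3`, `R_b(P)/log₂ P → 1/3`, and hence the sum rate satisfies
`(R_a(P)+R_b(P))/log₂ P → 2/3` as `P → ∞`. -/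
theorem af_tdbc_high_snr (m : ℕ) (hm : 1 ≤ m) (f g : Fin m → ℝ) (d : ℝ)
    (hf : ∀ i, 0 < f i) (hg : ∀ i, 0 < g i) (hd : 0 < d)
    (Pt : ℝ → Fin m → ℝ)
    (hPt : ∀ P i, Pt P i = (P / (m : ℝ)) / (P * (f i + g i) + 2))
    (Ra Rb : ℝ → ℝ)
    (hRa : ∀ P, Ra P = (1 / 3) * Real.logb 2 (1 + d * P +
        P * (∑ i, Real.sqrt (g i * f i * Pt P i)) ^ 2 /
          (2 * (∑ i, g i * Pt P i) + 1)))
    (hRb : ∀ P, Rb P = (1 / 3) * Real.logb 2 (1 + d * P +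
        P * (∑ i, Real.sqrt (g i * f i * Pt P i)) ^ 2 /
          (2 * (∑ i, f i * Pt P i) + 1))) :
    Filter.Tendsto (fun P => Ra P / Real.logb 2 P) Filter.atTop (nhds (1 / 3)) ∧
    Filter.Tendsto (fun P => Rb P / Real.logb 2 P) Filter.atTop (nhds (1 / 3)) ∧
    Filter.Tendsto (fun P => (Ra P + Rb P) / Real.logb 2 P) Filter.atTop (nhds (2 / 3)) := by
  have hm1 : (1 : ℝ) ≤ m := by exact_mod_cast hm
  have hPt0 (P : ℝ) (hP : 0 < P) (i : Fin m) : 0 ≤ Pt P i := by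
    have := hf i
    have := hg i
    rw [hPt]
    positivity
  have hPtB (P : ℝ) (hP : 0 < P) (i : Fin m) : Pt P i ≤ 1 / (f i + g i) := by
    have hfg := add_pos (hf i) (hg i)
    have : P / m ≤ P := div_le_self hP.le hm1
    rw [hPt, div_le_div_iff₀ (by positivity) hfg]
    nlinarith
  have hw (i : Fin m) : 0 ≤ g i * f i := (mul_pos (hg i) (hf i)).le
  have hA := tendsto_af_rate_div_logb_s12 hw (fun i => (hg i).le) hd hPt0 hPtB hRa
  have hB := tendsto_af_rate_div_logb_s12 hw (fun i => (hf i).le) hd hPt0 hPtB hRb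
  refine ⟨hA, hB, ?_⟩
  convert hA.add hB using 2
  · rw [add_div]
  · norm_num
end

section
/- Let m ≥ 1 be a natural number and h > 0. Define f(P) = sup over Δ₁ ∈ [0,1] of min( Δ₁·log₂(1+Ph²), 2·min( Δ₁·log₂(1+Ph²/2), (1−Δ₁)·log₂(1+mPh²) ) ). Then lim_{P→∞} f(P)/log₂ P = 2/3. -/
open Filter Topology in
theorem tendsto_logb_one_add_mul_div_logb {k : ℝ} (hk : 0 < k) :
    Tendsto (fun P : ℝ => Real.logb 2 (1 + k * P) / Real.logb 2 P) atTop (𝓝 1) := by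
  have h_num : Tendsto (fun P : ℝ => Real.log (P⁻¹ + k)) atTop (𝓝 (Real.log (0 + k))) :=
    (tendsto_inv_atTop_zero.add_const k).log (by simpa using hk.ne')
  have h_lim := (h_num.div_atTop Real.tendsto_log_atTop).const_add 1
  rw [add_zero] at h_lim
  refine h_lim.congr' ?_
  filter_upwards [eventually_gt_atTop 1] with P hP
  have hP0 : 0 < P := by linarith
  have h_log : Real.log P ≠ 0 := (Real.log_pos hP).ne'
  have h_log_two : Real.log 2 ≠ 0 := (Real.log_pos one_lt_two).ne'
  have h_eq : 1 + k * P = P * (P⁻¹ + k) := by field_simp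
  rw [h_eq, Real.logb, Real.logb, Real.log_mul hP0.ne' (by positivity)]
  field_simp

/-- Time-sharing between durations `t` and `1 - t` yields at most the harmonic-type bound
at which the two linear constraints balance. -/
theorem min_mul_le_div {A B C t : ℝ} (hA : 0 < A) (hC : 0 < C) :
    min (t * A) (2 * min (t * B) ((1 - t) * C)) ≤ 2 * A * C / (A + 2 * C) := by
  have h₁ := min_le_left (t * A) (2 * min (t * B) ((1 - t) * C))
  have h₂ := min_le_right (t * A) (2 * min (t * B) ((1 - t) * C))
  have h₃ := min_le_right (t * B) ((1 - t) * C)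
  generalize min (t * A) (2 * min (t * B) ((1 - t) * C)) = x at *
  rw [le_div_iff₀ (by positivity)]
  have h₄ : x ≤ 2 * ((1 - t) * C) := by linarith
  nlinarith [mul_le_mul_of_nonneg_right h₁ hC.le, mul_le_mul_of_nonneg_right h₄ hA.le]

/-- High-SNR behavior of the optimized achievable sum rate of the Gaussian (m,2) DF MABC
protocol with equal squared gains `h²`: `f(P)/log₂ P → 2/3` as `P → ∞`. -/
theorem df_mabc_high_snr (m : ℕ) (hm : 1 ≤ m) (h : ℝ) (hh : 0 < h)
    (f : ℝ → ℝ)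
    (hf : ∀ P, f P = sSup {x : ℝ | ∃ Δ₁ : ℝ, 0 ≤ Δ₁ ∧ Δ₁ ≤ 1 ∧
        x = min (Δ₁ * Real.logb 2 (1 + P * h ^ 2))
              (2 * min (Δ₁ * Real.logb 2 (1 + P * h ^ 2 / 2))
                ((1 - Δ₁) * Real.logb 2 (1 + (m : ℝ) * P * h ^ 2)))}) :
    Filter.Tendsto (fun P => f P / Real.logb 2 P) Filter.atTop (nhds (2 / 3)) := by
  have hm0 : (0 : ℝ) < m := by exact_mod_cast hm
  have hA := tendsto_logb_one_add_mul_div_logb (k := h ^ 2) (by positivity)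
  have hB := tendsto_logb_one_add_mul_div_logb (k := h ^ 2 / 2) (by positivity)
  have hC := tendsto_logb_one_add_mul_div_logb (k := m * h ^ 2) (by positivity)
  have h_lower := (hA.const_mul (2 / 3)).min
    (((hB.const_mul (2 / 3)).min (hC.const_mul (1 - 2 / 3))).const_mul 2)
  have h_upper := ((hA.const_mul 2).mul hC).div (hA.add (hC.const_mul 2)) (by norm_num)
  norm_num [Pi.div_def] at h_lower h_upper
  refine tendsto_of_tendsto_of_tendsto_of_le_of_le' h_lower h_upper ?_ ?_
  all_goals
    filter_upwards [Filter.eventually_gt_atTop 1] with P hP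
    have hP0 : 0 < P := by linarith
    have hL : 0 < Real.logb 2 P := Real.logb_pos one_lt_two hP
    have hA0 : 0 < Real.logb 2 (1 + P * h ^ 2) :=
      Real.logb_pos one_lt_two (lt_add_of_pos_right 1 (by positivity))
    have hC0 : 0 < Real.logb 2 (1 + (m : ℝ) * P * h ^ 2) :=
      Real.logb_pos one_lt_two (lt_add_of_pos_right 1 (by positivity))
    rw [hf, show h ^ 2 * P = P * h ^ 2 by ring, show m * h ^ 2 * P = m * P * h ^ 2 by ring]
  · rw [show h ^ 2 / 2 * P = P * h ^ 2 / 2 by ring, le_div_iff₀ hL]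
    refine le_csSup ⟨2 * Real.logb 2 (1 + P * h ^ 2) * Real.logb 2 (1 + m * P * h ^ 2) /
      (Real.logb 2 (1 + P * h ^ 2) + 2 * Real.logb 2 (1 + m * P * h ^ 2)), ?_⟩
      ⟨2 / 3, by norm_num, by norm_num, ?_⟩
    · rintro x ⟨t, -, -, rfl⟩
      exact min_mul_le_div hA0 hC0
    · rw [min_mul_of_nonneg _ _ hL.le, mul_assoc 2, min_mul_of_nonneg _ _ hL.le]
      field_simp
      norm_num
  · rw [div_le_iff₀ hL]
    refine csSup_le ⟨_, 0, le_rfl, zero_le_one, rfl⟩ ?_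
    rintro x ⟨t, -, -, rfl⟩
    refine (min_mul_le_div hA0 hC0).trans_eq ?_
    field_simp
end

section
/- Let m ≥ 1 be a natural number and h > 0. Define f(P) = sup over Δ₁ ∈ [0,1] of min( Δ₁·log₂(1+Ph²), 2·min( Δ₁·log₂(1+Ph²/2), (1−Δ₁)·log₂(1+mPh²) ) ). Then lim_{P→0⁺} f(P)·(ln 2)/(P h²) = 2m/(2m+1). -/
open Filter Topology in
/-- `log (1 + k x) / x → k` as `x → 0⁺`. -/
theorem tendsto_log_one_add_mul_div (k : ℝ) :
    Tendsto (fun x : ℝ => Real.log (1 + k * x) / x) (𝓝[>] 0) (𝓝 k) := by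
  have hd : HasDerivAt (fun x : ℝ => Real.log (1 + k * x)) k 0 := by
    have h1 : HasDerivAt (fun x : ℝ => 1 + k * x) k 0 := by
      simpa using ((hasDerivAt_id (0 : ℝ)).const_mul k).const_add 1
    simpa using h1.log (by simp)
  have hs := hd.tendsto_slope_zero_right
  refine hs.congr fun x => ?_
  simp [div_eq_inv_mul]

/-- Time sharing between two phases: when the constraint `A ≤ 2 * B` makes `B` inactive, the
optimal split balances the two remaining terms. -/
theorem isGreatest_two_phase_min {A B C : ℝ} (hA : 0 < A) (hC : 0 < C) (hAB : A ≤ 2 * B) :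
    IsGreatest {x : ℝ | ∃ d : ℝ, 0 ≤ d ∧ d ≤ 1 ∧ x = min (d * A) (2 * min (d * B) ((1 - d) * C))}
      (2 * A * C / (A + 2 * C)) := by
  have hS : 0 < A + 2 * C := by positivity
  constructor
  · refine ⟨2 * C / (A + 2 * C), by positivity, (div_le_one hS).2 (by linarith), ?_⟩
    have h1 : 2 * C / (A + 2 * C) * A = 2 * A * C / (A + 2 * C) := by ring
    have h2 : 2 * ((1 - 2 * C / (A + 2 * C)) * C) = 2 * A * C / (A + 2 * C) := by
      field_simp
      ring
    have h3 : 2 * A * C / (A + 2 * C) ≤ 2 * (2 * C / (A + 2 * C) * B) := by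
      rw [← h1, mul_left_comm 2]
      gcongr
    rw [mul_min_of_nonneg _ _ zero_le_two, h1, h2, min_eq_right h3, min_self]
  · rintro x ⟨d, hd0, hd1, rfl⟩
    rw [le_div_iff₀ hS, mul_min_of_nonneg _ _ zero_le_two]
    set x := min (d * A) (min (2 * (d * B)) (2 * ((1 - d) * C)))
    have h1 : x ≤ d * A := min_le_left _ _
    have h2 : x ≤ 2 * ((1 - d) * C) := (min_le_right _ _).trans (min_le_right _ _)
    nlinarith [mul_le_mul_of_nonneg_right h1 hC.le, mul_le_mul_of_nonneg_right h2 hA.le]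

/-- `log₂ (1 + t) ≤ 2 log₂ (1 + t / 2)` for `t ≥ 0`. -/
theorem logb_two_one_add_le {t : ℝ} (ht : 0 ≤ t) :
    Real.logb 2 (1 + t) ≤ 2 * Real.logb 2 (1 + t / 2) := by
  have h := Real.logb_pow 2 (1 + t / 2) 2
  push_cast at h
  rw [← h]
  exact Real.logb_le_logb_of_le one_lt_two (by positivity) (by nlinarith [sq_nonneg t])

/-- Low-SNR behavior of the optimized achievable sum rate of the Gaussian (m,2) DF MABC
protocol with equal squared gains `h²`: `f(P)·ln 2/(Ph²) → 2m/(2m+1)` as `P → 0⁺`. -/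
theorem df_mabc_low_snr (m : ℕ) (hm : 1 ≤ m) (h : ℝ) (hh : 0 < h)
    (f : ℝ → ℝ)
    (hf : ∀ P, f P = sSup {x : ℝ | ∃ Δ₁ : ℝ, 0 ≤ Δ₁ ∧ Δ₁ ≤ 1 ∧
        x = min (Δ₁ * Real.logb 2 (1 + P * h ^ 2))
              (2 * min (Δ₁ * Real.logb 2 (1 + P * h ^ 2 / 2))
                ((1 - Δ₁) * Real.logb 2 (1 + (m : ℝ) * P * h ^ 2)))}) :
    Filter.Tendsto (fun P => f P * Real.log 2 / (P * h ^ 2))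
      (nhdsWithin 0 (Set.Ioi 0)) (nhds (2 * (m : ℝ) / (2 * (m : ℝ) + 1))) := by
  have hm0 : (0 : ℝ) < m := by exact_mod_cast hm
  have key : Filter.Tendsto
      (fun t : ℝ => 2 * (Real.log (1 + 1 * t) / t) * (Real.log (1 + m * t) / t) /
        (Real.log (1 + 1 * t) / t + 2 * (Real.log (1 + m * t) / t)))
      (nhdsWithin 0 (Set.Ioi 0)) (nhds (2 * 1 * (m : ℝ) / (1 + 2 * (m : ℝ)))) := by
    have h1 := tendsto_log_one_add_mul_div 1
    have h2 := tendsto_log_one_add_mul_div m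
    exact ((h1.const_mul 2).mul h2).div (h1.add (h2.const_mul 2)) (by positivity)
  have hscale : Filter.Tendsto (fun P : ℝ => P * h ^ 2)
      (nhdsWithin 0 (Set.Ioi 0)) (nhdsWithin 0 (Set.Ioi 0)) := by
    refine tendsto_nhdsWithin_iff.2 ⟨?_, ?_⟩
    · have hc : Continuous fun P : ℝ => P * h ^ 2 := by fun_prop
      simpa using (hc.tendsto 0).mono_left nhdsWithin_le_nhds
    · filter_upwards [self_mem_nhdsWithin] with P hP
      have hP' : 0 < P := hP
      exact Set.mem_Ioi.2 (by positivity)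
  have hlim := key.comp hscale
  rw [mul_one, add_comm 1] at hlim
  refine hlim.congr' ?_
  filter_upwards [self_mem_nhdsWithin] with P hP
  have ht : 0 < P * h ^ 2 := mul_pos hP (by positivity)
  have hmt : 0 < (m : ℝ) * (P * h ^ 2) := mul_pos hm0 ht
  have hA : 0 < Real.log (1 + P * h ^ 2) := Real.log_pos (by linarith)
  have hC : 0 < Real.log (1 + m * (P * h ^ 2)) := Real.log_pos (by linarith)
  have hl : 0 < Real.log 2 := Real.log_pos one_lt_two
  rw [hf P, mul_assoc (m : ℝ), (isGreatest_two_phase_min (A := Real.logb 2 (1 + P * h ^ 2))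
    (C := Real.logb 2 (1 + m * (P * h ^ 2))) (div_pos hA hl) (div_pos hC hl)
    (logb_two_one_add_le ht.le)).csSup_eq]
  simp only [Function.comp_apply, one_mul, Real.logb]
  generalize P * h ^ 2 = t at *
  field_simp
end

section
/- Let m ≥ 1 be a natural number, P > 0, and 0 < h_min ≤ h_max, and suppose all squared channel gains a_1,…,a_m (terminal a to relays) and b_1,…,b_m (terminal b to relays) lie in the interval [h_min², h_max²]. Define the linearized (m,2) DF MABC achievable sum rate S_in = sup over Δ₁ ∈ [0,1] and R_a, R_b ≥ 0 satisfying R_a ≤ min( min_i Δ₁·P·a_i/(2 ln 2), (1−Δ₁)·P·(Σ_i b_i)/ln 2 ), R_b ≤ min( min_i Δ₁·P·b_i/(2 ln 2), (1−Δ₁)·P·(Σ_i a_i)/ln 2 ), and R_a + R_b ≤ min_i Δ₁·P·(a_i+b_i)/(2 ln 2), of R_a + R_b, and the linearized outer-bound sum rate S_out = sup over Δ₁ ∈ [0,1] of [ min_{S⊆{1,…,m}} (Δ₁·Σ_{i∉S} a_i·P/2 + (1−Δ₁)·Σ_{i∈S} b_i·P)/ln 2 + min_{S⊆{1,…,m}}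 (Δ₁·Σ_{i∉S} b_i·P/2 + (1−Δ₁)·Σ_{i∈S} a_i·P)/ln 2 ]. Then S_in ≥ (2m/(2m+1))·P·h_min²/ln 2, S_out ≤ 2m·P·h_max²/ln 2, and hence S_in/S_out ≥ (1/(2m+1))·(h_min²/h_max²). -/
/-- The linearized minimum cut is at most the value of the cut with no relay on the source side. -/
lemma sInf_cut_le {m : ℕ} {P h L Δ : ℝ} (hP : 0 < P) (hL : 0 < L) (h0 : 0 ≤ Δ) (h1 : Δ ≤ 1)
    (a b : Fin m → ℝ) (ha : ∀ i, a i ≤ h) (hh : 0 ≤ h) :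
    sInf {x : ℝ | ∃ S : Finset (Fin m),
      x = (Δ * (∑ i ∈ Sᶜ, a i) * P / 2 + (1 - Δ) * (∑ i ∈ S, b i) * P) / L} ≤
      (m : ℝ) * P * h / L := by
  have hfin : {x : ℝ | ∃ S : Finset (Fin m),
      x = (Δ * (∑ i ∈ Sᶜ, a i) * P / 2 + (1 - Δ) * (∑ i ∈ S, b i) * P) / L}.Finite :=
    (Set.finite_range fun S : Finset (Fin m) =>
      (Δ * (∑ i ∈ Sᶜ, a i) * P / 2 + (1 - Δ) * (∑ i ∈ S, b i) * P) / L).subset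
      fun x ⟨S, hS⟩ => ⟨S, hS.symm⟩
  refine (csInf_le hfin.bddBelow ⟨∅, rfl⟩).trans ?_
  have hsum : ∑ i, a i ≤ m * h := by
    simpa using Finset.sum_le_card_nsmul Finset.univ a h fun i _ => ha i
  have hmh : 0 ≤ m * h := by positivity
  have hΔ : Δ * ∑ i, a i ≤ m * h :=
    (mul_le_mul_of_nonneg_left hsum h0).trans (mul_le_of_le_one_left hmh h1)
  simp only [Finset.compl_empty, Finset.sum_empty]
  gcongr
  nlinarith [mul_le_mul_of_nonneg_right hΔ hP.le, mul_nonneg hmh hP.le]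

/-- When the first phase lasts two thirds of the time, both phases weigh equally in each cut. -/
lemma le_sInf_cut {m : ℕ} {P h L : ℝ} (hP : 0 < P) (hL : 0 < L)
    (a b : Fin m → ℝ) (ha : ∀ i, h ≤ a i) (hb : ∀ i, h ≤ b i) :
    (m : ℝ) * P * h / (3 * L) ≤ sInf {x : ℝ | ∃ S : Finset (Fin m),
      x = (2 / 3 * (∑ i ∈ Sᶜ, a i) * P / 2 + (1 - 2 / 3) * (∑ i ∈ S, b i) * P) / L} := by
  refine le_csInf ⟨_, ∅, rfl⟩ ?_
  rintro x ⟨S, rfl⟩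
  have hS : (S.card : ℝ) * h ≤ ∑ i ∈ S, b i := by
    simpa using Finset.card_nsmul_le_sum S b h fun i _ => hb i
  have hSc : (Sᶜ.card : ℝ) * h ≤ ∑ i ∈ Sᶜ, a i := by
    simpa using Finset.card_nsmul_le_sum Sᶜ a h fun i _ => ha i
  have hcard : (S.card : ℝ) + Sᶜ.card = m := by
    exact_mod_cast (Finset.card_add_card_compl S).trans (Fintype.card_fin m)
  rw [← div_div]
  gcongr
  rw [← hcard]
  nlinarith [mul_le_mul_of_nonneg_right (add_le_add hS hSc) hP.le]

/-- Low-SNR (linearized) multiplicative-gap lower bound for the (m,2) DF MABC protocol: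
with all squared gains in `[h_min², h_max²]`, the linearized achievable sum rate `S_in`
satisfies `S_in ≥ (2m/(2m+1))·P·h_min²/ln 2`, the linearized outer-bound sum rate
satisfies `S_out ≤ 2m·P·h_max²/ln 2`, and hence
`S_in/S_out ≥ (1/(2m+1))·(h_min²/h_max²)`. -/
theorem df_mabc_low_snr_gap (m : ℕ) (hm : 1 ≤ m) (P hmin hmax : ℝ) (hP : 0 < P)
    (h1 : 0 < hmin) (h2 : hmin ≤ hmax)
    (a b : Fin m → ℝ)
    (ha : ∀ i, hmin ^ 2 ≤ a i ∧ a i ≤ hmax ^ 2)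
    (hb : ∀ i, hmin ^ 2 ≤ b i ∧ b i ≤ hmax ^ 2)
    (Sin Sout : ℝ)
    (hSin : Sin = sSup {s : ℝ | ∃ Δ₁ Ra Rb : ℝ, 0 ≤ Δ₁ ∧ Δ₁ ≤ 1 ∧ 0 ≤ Ra ∧ 0 ≤ Rb ∧
        (∀ i, Ra ≤ Δ₁ * P * a i / (2 * Real.log 2)) ∧
        Ra ≤ (1 - Δ₁) * P * (∑ i, b i) / Real.log 2 ∧
        (∀ i, Rb ≤ Δ₁ * P * b i / (2 * Real.log 2)) ∧
        Rb ≤ (1 - Δ₁) * P * (∑ i, a i) / Real.log 2 ∧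
        (∀ i, Ra + Rb ≤ Δ₁ * P * (a i + b i) / (2 * Real.log 2)) ∧
        s = Ra + Rb})
    (hSout : Sout = sSup {s : ℝ | ∃ Δ₁ : ℝ, 0 ≤ Δ₁ ∧ Δ₁ ≤ 1 ∧
        s = sInf {x : ℝ | ∃ S : Finset (Fin m),
              x = (Δ₁ * (∑ i ∈ Sᶜ, a i) * P / 2
                    + (1 - Δ₁) * (∑ i ∈ S, b i) * P) / Real.log 2}
          + sInf {x : ℝ | ∃ S : Finset (Fin m),
              x = (Δ₁ * (∑ i ∈ Sᶜ, b i) * P / 2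
                    + (1 - Δ₁) * (∑ i ∈ S, a i) * P) / Real.log 2}}) :
    2 * (m : ℝ) / (2 * (m : ℝ) + 1) * P * hmin ^ 2 / Real.log 2 ≤ Sin ∧
    Sout ≤ 2 * (m : ℝ) * P * hmax ^ 2 / Real.log 2 ∧
    1 / (2 * (m : ℝ) + 1) * (hmin ^ 2 / hmax ^ 2) ≤ Sin / Sout := by
  have hL : 0 < Real.log 2 := Real.log_pos one_lt_two
  have hm0 : (0 : ℝ) < m := by exact_mod_cast hm
  have hmin2 : 0 < hmin ^ 2 := by positivity
  have hmax2 : 0 < hmax ^ 2 := by have := h1.trans_le h2; positivity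
  have hin : 2 * (m : ℝ) / (2 * (m : ℝ) + 1) * P * hmin ^ 2 / Real.log 2 ≤ Sin := by
    have hsum : ∀ c : Fin m → ℝ, (∀ i, hmin ^ 2 ≤ c i) → m * hmin ^ 2 ≤ ∑ i, c i := fun c hc => by
      simpa using Finset.card_nsmul_le_sum Finset.univ c (hmin ^ 2) fun i _ => hc i
    have hphase : ∀ c : ℝ, hmin ^ 2 ≤ c → m / (2 * (m : ℝ) + 1) * P * hmin ^ 2 / Real.log 2 ≤
        2 * m / (2 * (m : ℝ) + 1) * P * c / (2 * Real.log 2) := fun c hc => by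
      calc _ ≤ m / (2 * (m : ℝ) + 1) * P * c / Real.log 2 := by gcongr
        _ = _ := by field_simp
    have hbroadcast : ∀ c : Fin m → ℝ, (∀ i, hmin ^ 2 ≤ c i) →
        m / (2 * (m : ℝ) + 1) * P * hmin ^ 2 / Real.log 2 ≤
        (1 - 2 * m / (2 * (m : ℝ) + 1)) * P * (∑ i, c i) / Real.log 2 := fun c hc => by
      calc _ = 1 / (2 * (m : ℝ) + 1) * P * (m * hmin ^ 2) / Real.log 2 := by ring
        _ ≤ 1 / (2 * (m : ℝ) + 1) * P * (∑ i, c i) / Real.log 2 := by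
          have := hsum c hc
          gcongr
        _ = _ := by congr 3; field_simp; ring
    rw [hSin]
    refine le_csSup ⟨P * (a ⟨0, hm⟩ + b ⟨0, hm⟩) / (2 * Real.log 2), ?_⟩
      ⟨2 * m / (2 * m + 1), m / (2 * m + 1) * P * hmin ^ 2 / Real.log 2,
        m / (2 * m + 1) * P * hmin ^ 2 / Real.log 2, by positivity, ?_, by positivity,
        by positivity, fun i => hphase _ (ha i).1, hbroadcast b fun i => (hb i).1,
        fun i => hphase _ (hb i).1, hbroadcast a fun i => (ha i).1, fun i => ?_, by ring⟩
    · rintro s ⟨Δ, Ra, Rb, -, hΔ, -, -, -, -, -, -, h, rfl⟩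
      refine (h ⟨0, hm⟩).trans ?_
      have : 0 ≤ a ⟨0, hm⟩ + b ⟨0, hm⟩ :=
        add_nonneg (hmin2.le.trans (ha _).1) (hmin2.le.trans (hb _).1)
      gcongr
      exact mul_le_of_le_one_left hP.le hΔ
    · rw [div_le_one (by positivity)]
      linarith
    · exact (add_le_add (hphase _ (ha i).1) (hphase _ (hb i).1)).trans_eq (by ring)
  have hub : ∀ s ∈ {s : ℝ | ∃ Δ₁ : ℝ, 0 ≤ Δ₁ ∧ Δ₁ ≤ 1 ∧
        s = sInf {x : ℝ | ∃ S : Finset (Fin m),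
              x = (Δ₁ * (∑ i ∈ Sᶜ, a i) * P / 2
                    + (1 - Δ₁) * (∑ i ∈ S, b i) * P) / Real.log 2}
          + sInf {x : ℝ | ∃ S : Finset (Fin m),
              x = (Δ₁ * (∑ i ∈ Sᶜ, b i) * P / 2
                    + (1 - Δ₁) * (∑ i ∈ S, a i) * P) / Real.log 2}},
      s ≤ 2 * (m : ℝ) * P * hmax ^ 2 / Real.log 2 := by
    rintro s ⟨Δ, h0, hΔ, rfl⟩
    exact (add_le_add (sInf_cut_le hP hL h0 hΔ a b (fun i => (ha i).2) hmax2.le)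
      (sInf_cut_le hP hL h0 hΔ b a (fun i => (hb i).2) hmax2.le)).trans_eq (by ring)
  have hout : Sout ≤ 2 * (m : ℝ) * P * hmax ^ 2 / Real.log 2 := by
    rw [hSout]
    exact csSup_le ⟨_, 0, le_rfl, zero_le_one, rfl⟩ hub
  have hpos : 0 < Sout := by
    have hcut : 0 < m * P * hmin ^ 2 / (3 * Real.log 2) := by positivity
    rw [hSout]
    refine lt_of_lt_of_le (add_pos
      (hcut.trans_le (le_sInf_cut hP hL a b (fun i => (ha i).1) fun i => (hb i).1))
      (hcut.trans_le (le_sInf_cut hP hL b a (fun i => (hb i).1) fun i => (ha i).1)))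
      (le_csSup ⟨_, hub⟩ ⟨2 / 3, by norm_num, by norm_num, rfl⟩)
  refine ⟨hin, hout, ?_⟩
  calc 1 / (2 * (m : ℝ) + 1) * (hmin ^ 2 / hmax ^ 2)
      = 2 * (m : ℝ) / (2 * (m : ℝ) + 1) * P * hmin ^ 2 / Real.log 2 /
          (2 * (m : ℝ) * P * hmax ^ 2 / Real.log 2) := by
        have := h1.trans_le h2
        field_simp
    _ ≤ Sin / Sout := div_le_div₀ (le_trans (by positivity) hin) hin hpos hout
end

section
/- Let m ≥ 1 be a natural number, P > 0, and 0 < h_min ≤ h_max, and suppose every squared channel gain g_{i,j} = |h_{r_i,r_j}|² between nodes of the chain r_0 (terminal a), r_1,…,r_m (relays), r_{m+1} (terminal b) lies in [h_min², h_max²]. Define the linearized (m,m+2) DF MHMR achievable sum rate S_in = sup over duration vectors Δ = (Δ₁,…,Δ_{m+2}) (nonnegative, summing to 1) and R_a, R_b ≥ 0 satisfying R_a ≤ min_{1≤k≤m+1} Σ_{i=1}^{k} Δ_{m+3−i}·P·g_{i−1,k}/ln 2 and R_b ≤ min_{1≤k≤m+1} Σ_{i=1}^{k} Δ_i·P·g_{m+2−i,m+1−k}/ln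 2, of R_a + R_b, and the linearized outer-bound sum rate S_out = sup over duration vectors Δ of [ min_{S⊆{1,…,m}} Σ_{i∈S∪{0}} Δ_{m+2−i}·P·(Σ_{j∈({1,…,m}∖S)∪{m+1}} g_{i,j})/ln 2 + min_{S⊆{1,…,m}} Σ_{i∈S∪{m+1}} Δ_{m+2−i}·P·(Σ_{j∈({1,…,m}∖S)∪{0}} g_{i,j})/ln 2 ]. Then S_in ≥ P·h_min²/ln 2, S_out ≤ 2·P·h_max²/ln 2, and hence S_in/S_out ≥ (1/2)·(h_min²/h_max²). -/
/-- Nonnegative weights summing to one, reindexed along an injection and scaled by terms of size at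
most `b`, have a total of at most `b`. -/
lemma sum_weights_mul_le {s t : Finset ℕ} {w G : ℕ → ℝ} {f : ℕ → ℕ} {b : ℝ}
    (hw : ∀ i ∈ s, 0 ≤ w i) (hsum : ∑ i ∈ s, w i = 1) (hb : 0 ≤ b)
    (hf : ∀ i ∈ t, f i ∈ s) (hinj : Set.InjOn f t) (hG : ∀ i ∈ t, G i ≤ b) :
    ∑ i ∈ t, w (f i) * G i ≤ b := by
  have himage : t.image f ⊆ s := Finset.image_subset_iff.mpr hf
  calc ∑ i ∈ t, w (f i) * G i ≤ ∑ i ∈ t, w (f i) * b :=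
        Finset.sum_le_sum fun i hi => mul_le_mul_of_nonneg_left (hG i hi) (hw _ (hf i hi))
    _ = (∑ j ∈ t.image f, w j) * b := by rw [Finset.sum_image hinj, Finset.sum_mul]
    _ ≤ 1 * b := by
        rw [← hsum]
        exact mul_le_mul_of_nonneg_right
          (Finset.sum_le_sum_of_subset_of_nonneg himage fun i hi _ => hw i hi) hb
    _ = b := one_mul b

/-- The supremum of a set of reals bounded above by `b` and containing a point `s ≥ a` lies in
`[a, b]`. -/
lemma sSup_mem_Icc {T : Set ℝ} {a b s : ℝ} (hs : s ∈ T) (ha : a ≤ s) (hb : ∀ x ∈ T, x ≤ b) :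
    a ≤ sSup T ∧ sSup T ≤ b :=
  ⟨le_csSup_of_le ⟨b, hb⟩ hs ha, csSup_le ⟨s, hs⟩ hb⟩

/-- The rate across a cut of the chain (senders `insert a S`, receivers `insert b (Icc 1 m \ S)`)
is nonnegative. -/
lemma cut_rate_nonneg {m a b : ℕ} {P : ℝ} {g : ℕ → ℕ → ℝ} {w : ℕ → ℝ} (hP : 0 ≤ P)
    (ha : a ≤ m + 1) (hb : b ≤ m + 1) (haI : a ∉ Finset.Icc 1 m) (hbI : b ∉ Finset.Icc 1 m)
    (hab : a ≠ b)
    (hg : ∀ i j, i ≤ m + 1 → j ≤ m + 1 → i ≠ j → 0 ≤ g i j)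
    (hw : ∀ i ≤ m + 1, 0 ≤ w (m + 2 - i))
    {S : Finset ℕ} (hS : S ⊆ Finset.Icc 1 m) :
    ∀ i ∈ insert a S, 0 ≤ w (m + 2 - i) * P *
      (∑ j ∈ insert b (Finset.Icc 1 m \ S), g i j) / Real.log 2 := by
  intro i hi
  have hlog : 0 ≤ Real.log 2 := Real.log_nonneg one_le_two
  have hile : i ≤ m + 1 := by
    rcases Finset.mem_insert.mp hi with rfl | hi
    · exact ha
    · have := Finset.mem_Icc.mp (hS hi)
      omega
  refine div_nonneg (mul_nonneg (mul_nonneg (hw i hile) hP) (Finset.sum_nonneg ?_)) hlog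
  intro j hj
  refine hg i j hile ?_ ?_
  · rcases Finset.mem_insert.mp hj with rfl | hj
    · exact hb
    · have := Finset.mem_Icc.mp (Finset.mem_sdiff.mp hj).1
      omega
  · rintro rfl
    rcases Finset.mem_insert.mp hi with rfl | hi <;> rcases Finset.mem_insert.mp hj with h | hj
    · exact hab h
    · exact haI (Finset.mem_sdiff.mp hj).1
    · exact hbI (h ▸ hS hi)
    · exact (Finset.mem_sdiff.mp hj).2 hi

/-- Low-SNR (linearized) multiplicative-gap lower bound for the (m, m+2) DF MHMR protocol:
with all squared channel gains `g i j` of the chain `r_0 (= a), r_1, …, r_m, r_{m+1} (= b)`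
in `[h_min², h_max²]`, the linearized achievable sum rate satisfies
`S_in ≥ P·h_min²/ln 2`, the linearized cut-set outer-bound sum rate satisfies
`S_out ≤ 2·P·h_max²/ln 2`, and hence `S_in/S_out ≥ (1/2)·(h_min²/h_max²)`,
independently of `m`. -/
theorem df_mhmr_low_snr_gap (m : ℕ) (hm : 1 ≤ m) (P hmin hmax : ℝ) (hP : 0 < P)
    (h1 : 0 < hmin) (h2 : hmin ≤ hmax)
    (g : ℕ → ℕ → ℝ)
    (hg : ∀ i j, i ≤ m + 1 → j ≤ m + 1 → i ≠ j →
      hmin ^ 2 ≤ g i j ∧ g i j ≤ hmax ^ 2)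
    (Sin Sout : ℝ)
    (hSin : Sin = sSup {s : ℝ | ∃ (Δ : ℕ → ℝ) (Ra Rb : ℝ),
        (∀ i ∈ Finset.Icc 1 (m + 2), 0 ≤ Δ i) ∧
        (∑ i ∈ Finset.Icc 1 (m + 2), Δ i) = 1 ∧ 0 ≤ Ra ∧ 0 ≤ Rb ∧
        (∀ k ∈ Finset.Icc 1 (m + 1),
          Ra ≤ ∑ i ∈ Finset.Icc 1 k, Δ (m + 3 - i) * P * g (i - 1) k / Real.log 2) ∧
        (∀ k ∈ Finset.Icc 1 (m + 1),
          Rb ≤ ∑ i ∈ Finset.Icc 1 k,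
                Δ i * P * g (m + 2 - i) (m + 1 - k) / Real.log 2) ∧
        s = Ra + Rb})
    (hSout : Sout = sSup {s : ℝ | ∃ Δ : ℕ → ℝ,
        (∀ i ∈ Finset.Icc 1 (m + 2), 0 ≤ Δ i) ∧
        (∑ i ∈ Finset.Icc 1 (m + 2), Δ i) = 1 ∧
        s = sInf {x : ℝ | ∃ S : Finset ℕ, S ⊆ Finset.Icc 1 m ∧
              x = ∑ i ∈ insert 0 S, Δ (m + 2 - i) * P *
                    (∑ j ∈ insert (m + 1) (Finset.Icc 1 m \ S), g i j) / Real.log 2}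
          + sInf {x : ℝ | ∃ S : Finset ℕ, S ⊆ Finset.Icc 1 m ∧
              x = ∑ i ∈ insert (m + 1) S, Δ (m + 2 - i) * P *
                    (∑ j ∈ insert 0 (Finset.Icc 1 m \ S), g i j) / Real.log 2}}) :
    P * hmin ^ 2 / Real.log 2 ≤ Sin ∧
    Sout ≤ 2 * P * hmax ^ 2 / Real.log 2 ∧
    1 / 2 * (hmin ^ 2 / hmax ^ 2) ≤ Sin / Sout := by
  have hL : 0 < Real.log 2 := Real.log_pos one_lt_two
  have hmax0 : 0 < hmax := h1.trans_le h2
  have hA : 0 < P * hmin ^ 2 / Real.log 2 := by positivity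
  have hB : 0 < P * hmax ^ 2 / Real.log 2 := by positivity
  have hg0 : ∀ i j, i ≤ m + 1 → j ≤ m + 1 → i ≠ j → 0 ≤ g i j := fun i j hi hj hij =>
    (sq_nonneg hmin).trans (hg i j hi hj hij).1
  have hlow : ∀ i j, i ≤ m + 1 → j ≤ m + 1 → i ≠ j →
      P * hmin ^ 2 / Real.log 2 ≤ P * g i j / Real.log 2 := fun i j hi hj hij =>
    div_le_div_of_nonneg_right (mul_le_mul_of_nonneg_left (hg i j hi hj hij).1 hP.le) hL.le
  have hupp : ∀ i j, i ≤ m + 1 → j ≤ m + 1 → i ≠ j →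
      P * g i j / Real.log 2 ≤ P * hmax ^ 2 / Real.log 2 := fun i j hi hj hij =>
    div_le_div_of_nonneg_right (mul_le_mul_of_nonneg_left (hg i j hi hj hij).2 hP.le) hL.le
  -- Terminal `a` transmits all the time.
  set D : ℕ → ℝ := fun i => if i = m + 2 then 1 else 0 with hD
  have hD0 : ∀ i, 0 ≤ D i := fun i => by simp only [hD]; split_ifs <;> norm_num
  have hDtop : D (m + 2) = 1 := if_pos rfl
  have hDsum : ∑ i ∈ Finset.Icc 1 (m + 2), D i = 1 := by simp [hD]
  have hin : P * hmin ^ 2 / Real.log 2 ≤ Sin := by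
    rw [hSin]
    apply le_csSup
    · refine ⟨P * hmax ^ 2 / Real.log 2 + P * hmax ^ 2 / Real.log 2, ?_⟩
      rintro s ⟨Δ, Ra, Rb, hΔ, hsum, -, -, hRa, hRb, rfl⟩
      have hone : (1 : ℕ) ∈ Finset.Icc 1 (m + 1) := Finset.mem_Icc.mpr ⟨le_rfl, by omega⟩
      refine add_le_add ((hRa 1 hone).trans ?_) ((hRb 1 hone).trans ?_)
      · simp only [mul_assoc, mul_div_assoc]
        refine sum_weights_mul_le (f := fun i => m + 3 - i) (G := fun i => P * (g (i - 1) 1 / _))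
          hΔ hsum (by positivity) ?_ ?_ ?_
        · simp
        · simp
        · intro i hi
          obtain rfl : i = 1 := by simpa using hi
          simpa only [mul_div_assoc] using hupp (1 - 1) 1 (by omega) (by omega) (by omega)
      · simp only [mul_assoc, mul_div_assoc]
        refine sum_weights_mul_le (f := fun i => i)
          (G := fun i => P * (g (m + 2 - i) (m + 1 - 1) / _)) hΔ hsum (by positivity) ?_ ?_ ?_
        · simp
        · simp
        · intro i hi
          obtain rfl : i = 1 := by simpa using hi
          simpa only [mul_div_assoc] using
            hupp (m + 2 - 1) (m + 1 - 1) (by omega) (by omega) (by omega)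
    · refine ⟨D, P * hmin ^ 2 / Real.log 2, 0, fun i _ => hD0 i, hDsum, hA.le, le_rfl, ?_, ?_,
        (add_zero _).symm⟩
      · intro k hk
        have hk' := Finset.mem_Icc.mp hk
        have hmem : (1 : ℕ) ∈ Finset.Icc 1 k := Finset.mem_Icc.mpr ⟨le_rfl, hk'.1⟩
        refine le_trans ?_ (Finset.single_le_sum
          (f := fun i => D (m + 3 - i) * P * g (i - 1) k / Real.log 2) ?_ hmem)
        · have h : m + 3 - 1 = m + 2 := by omega
          simp only [h, hDtop, one_mul]
          exact hlow _ _ (by omega) hk'.2 (by omega)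
        · intro i hi
          have hi' := Finset.mem_Icc.mp hi
          exact div_nonneg (mul_nonneg (mul_nonneg (hD0 _) hP.le)
            (hg0 _ _ (by omega) (by omega) (by omega))) hL.le
      · intro k hk
        have hk' := Finset.mem_Icc.mp hk
        refine Finset.sum_nonneg fun i hi => ?_
        have hi' := Finset.mem_Icc.mp hi
        exact div_nonneg (mul_nonneg (mul_nonneg (hD0 _) hP.le)
          (hg0 _ _ (by omega) (by omega) (by omega))) hL.le
  have hcut_a {Δ : ℕ → ℝ} (hΔ : ∀ i ∈ Finset.Icc 1 (m + 2), 0 ≤ Δ i) {S : Finset ℕ}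
      (hS : S ⊆ Finset.Icc 1 m) :=
    cut_rate_nonneg (a := 0) (b := m + 1) (w := Δ) hP.le (by omega) le_rfl (by simp) (by simp)
      (by omega) hg0 (fun i hi => hΔ _ (Finset.mem_Icc.mpr ⟨by omega, by omega⟩)) hS
  have hcut_b {Δ : ℕ → ℝ} (hΔ : ∀ i ∈ Finset.Icc 1 (m + 2), 0 ≤ Δ i) {S : Finset ℕ}
      (hS : S ⊆ Finset.Icc 1 m) :=
    cut_rate_nonneg (a := m + 1) (b := 0) (w := Δ) hP.le le_rfl (by omega) (by simp) (by simp)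
      (by omega) hg0 (fun i hi => hΔ _ (Finset.mem_Icc.mpr ⟨by omega, by omega⟩)) hS
  have hout : P * hmin ^ 2 / Real.log 2 ≤ Sout ∧ Sout ≤ 2 * P * hmax ^ 2 / Real.log 2 := by
    rw [hSout]
    refine sSup_mem_Icc ⟨D, fun i _ => hD0 i, hDsum, rfl⟩ ?_ ?_
    · refine le_add_of_le_of_nonneg
        (le_csInf ⟨_, Finset.Icc 1 m, subset_rfl, rfl⟩ ?_) (Real.sInf_nonneg ?_)
      · rintro x ⟨S, hS, rfl⟩
        refine le_trans ?_
          (Finset.single_le_sum (hcut_a (fun i _ => hD0 i) hS) (Finset.mem_insert_self 0 S))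
        simp only [Nat.sub_zero, hDtop, one_mul]
        refine (hlow 0 (m + 1) (by omega) le_rfl (by omega)).trans
          (div_le_div_of_nonneg_right (mul_le_mul_of_nonneg_left ?_ hP.le) hL.le)
        refine Finset.single_le_sum (f := fun j => g 0 j) (fun j hj => ?_)
          (Finset.mem_insert_self (m + 1) _)
        simp only [Finset.mem_insert, Finset.mem_sdiff, Finset.mem_Icc] at hj
        exact hg0 0 j (by omega) (by omega) (by omega)
      · rintro x ⟨S, hS, rfl⟩
        exact Finset.sum_nonneg (hcut_b (fun i _ => hD0 i) hS)
    · rintro s ⟨Δ, hΔ, hsum, rfl⟩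
      have htwo : 2 * P * hmax ^ 2 / Real.log 2 =
          P * hmax ^ 2 / Real.log 2 + P * hmax ^ 2 / Real.log 2 := by ring
      rw [htwo]
      refine add_le_add (csInf_le_of_le ?_ ⟨Finset.Icc 1 m, subset_rfl, rfl⟩ ?_)
        (csInf_le_of_le ?_ ⟨Finset.Icc 1 m, subset_rfl, rfl⟩ ?_)
      · refine ⟨0, ?_⟩
        rintro x ⟨S, hS, rfl⟩
        exact Finset.sum_nonneg (hcut_a hΔ hS)
      · simp only [sdiff_self, Finset.bot_eq_empty, insert_empty_eq, Finset.sum_singleton,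
          mul_assoc, mul_div_assoc]
        refine sum_weights_mul_le (f := fun i => m + 2 - i) (G := fun i => P * (g i (m + 1) / _))
          hΔ hsum (by positivity) ?_ ?_ ?_
        · intro i hi
          simp only [Finset.mem_insert, Finset.mem_Icc] at hi ⊢
          omega
        · intro i hi j hj hij
          simp only [Finset.coe_insert, Finset.coe_Icc, Set.mem_insert_iff, Set.mem_Icc] at hi hj hij
          omega
        · intro i hi
          simp only [Finset.mem_insert, Finset.mem_Icc] at hi
          simpa only [mul_div_assoc] using hupp i (m + 1) (by omega) (by omega) (by omega)
      · refine ⟨0, ?_⟩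
        rintro x ⟨S, hS, rfl⟩
        exact Finset.sum_nonneg (hcut_b hΔ hS)
      · simp only [sdiff_self, Finset.bot_eq_empty, insert_empty_eq, Finset.sum_singleton,
          mul_assoc, mul_div_assoc]
        refine sum_weights_mul_le (f := fun i => m + 2 - i) (G := fun i => P * (g i 0 / _))
          hΔ hsum (by positivity) ?_ ?_ ?_
        · intro i hi
          simp only [Finset.mem_insert, Finset.mem_Icc] at hi ⊢
          omega
        · intro i hi j hj hij
          simp only [Finset.coe_insert, Finset.coe_Icc, Set.mem_insert_iff, Set.mem_Icc] at hi hj hij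
          omega
        · intro i hi
          simp only [Finset.mem_insert, Finset.mem_Icc] at hi
          simpa only [mul_div_assoc] using hupp i 0 (by omega) (by omega) (by omega)
  refine ⟨hin, hout.2, ?_⟩
  calc 1 / 2 * (hmin ^ 2 / hmax ^ 2)
      = (P * hmin ^ 2 / Real.log 2) / (2 * P * hmax ^ 2 / Real.log 2) := by field_simp
    _ ≤ Sin / Sout := div_le_div₀ (hA.le.trans hin) hin (hA.trans_le hout.1) hout.2
end
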